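/- arXiv:1306.5289 — 2 statements merged into one kernel-verified Lean document; each statement's English description precedes it below -/
import Mathlib

section
/- Fix ν : ℝ → (0, ∞) and β = (β0, β1, β2) ∈ ℝ³, and let (p1, p2, p3, p4) be weights with p_i ≥ 0 and p1 + p2 + p3 + p4 = 1. The design ξ supported on the four boundary points (1,1), (1,−1), (−1,1), (−1,−1) with weights (p1, p2, p3, p4) is D-optimal on [−1,1] × [−1,1] if and only if, for every (a, b) ∈ [−1,1] × [−1,1], the allocation (p1, p2, p3, p4, 0) maximizes det M over all allocations (q1,…,q5) with q_i ≥ 0 and Σ q_i = 1 on the five points (1,1), (1,−1), (−1,1), (−1,−1), (a,b). -/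
open Finset

/-- The information matrix of a finitely supported design
`{((x i).1, (x i).2), p i}` under a generalized linear model with weight
function `ν` and parameters `β0, β1, β2`. -/
noncomputable def infoMat (ν : ℝ → ℝ) (β0 β1 β2 : ℝ) (m : ℕ)
    (x : Fin m → ℝ × ℝ) (p : Fin m → ℝ) : Matrix (Fin 3) (Fin 3) ℝ :=
  ∑ i, (p i * ν (β0 + β1 * (x i).1 + β2 * (x i).2)) •
    Matrix.vecMulVec ![1, (x i).1, (x i).2] ![1, (x i).1, (x i).2]

/-- `(x, p)` is a D-optimal (finitely supported) design on the region `R`. -/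
def IsDOptimal (ν : ℝ → ℝ) (β0 β1 β2 : ℝ) (R : Set (ℝ × ℝ)) (m : ℕ)
    (x : Fin m → ℝ × ℝ) (p : Fin m → ℝ) : Prop :=
  (∀ i, x i ∈ R) ∧ (∀ i, 0 ≤ p i) ∧ (∑ i, p i = 1) ∧
    ∀ (m' : ℕ) (x' : Fin m' → ℝ × ℝ) (p' : Fin m' → ℝ),
      (∀ i, x' i ∈ R) → (∀ i, 0 ≤ p' i) → (∑ i, p' i = 1) →
      (infoMat ν β0 β1 β2 m' x' p').det ≤ (infoMat ν β0 β1 β2 m x p).det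

open Matrix in
/-- The determinant of a positive semidefinite `3 × 3` matrix is at most the cube of the mean of its
eigenvalues. -/
lemma Matrix.PosSemidef.det_le_trace_div_three_pow {N : Matrix (Fin 3) (Fin 3) ℝ}
    (hN : N.PosSemidef) : N.det ≤ (N.trace / 3) ^ 3 := by
  have h (i : Fin 3) := hN.eigenvalues_nonneg i
  rw [hN.isHermitian.det_eq_prod_eigenvalues, hN.isHermitian.trace_eq_sum_eigenvalues]
  simp only [Fin.prod_univ_three, Fin.sum_univ_three, RCLike.ofReal_real_eq_id, id]
  generalize hN.isHermitian.eigenvalues = e at h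
  have h0 := h 0
  have h1 := h 1
  have h2 := h 2
  nlinarith [mul_nonneg h0 (sq_nonneg (e 1 - e 2)), mul_nonneg h1 (sq_nonneg (e 0 - e 2)),
    mul_nonneg h2 (sq_nonneg (e 0 - e 1)), mul_nonneg h0 (sq_nonneg (e 0 - e 1)),
    mul_nonneg h0 (sq_nonneg (e 0 - e 2)), mul_nonneg h1 (sq_nonneg (e 0 - e 1)),
    mul_nonneg h1 (sq_nonneg (e 1 - e 2)), mul_nonneg h2 (sq_nonneg (e 0 - e 2)),
    mul_nonneg h2 (sq_nonneg (e 1 - e 2))]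

open Matrix MatrixOrder in
lemma Matrix.det_le_det_of_trace_inv_mul_le {M N : Matrix (Fin 3) (Fin 3) ℝ} (hM : M.PosSemidef)
    (hdet : 0 < M.det) (hN : N.PosSemidef) (h : (M⁻¹ * N).trace ≤ 3) : N.det ≤ M.det := by
  obtain ⟨C, hC⟩ := CStarAlgebra.nonneg_iff_eq_star_mul_self.mp hM.inv.nonneg
  rw [star_eq_conjTranspose] at hC
  have hP := hN.mul_mul_conjTranspose_same C
  have htr : (C * N * Cᴴ).trace = (M⁻¹ * N).trace := by
    rw [trace_mul_comm, ← Matrix.mul_assoc, ← hC]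
  have hd : (C * N * Cᴴ).det = M.det⁻¹ * N.det := by
    rw [← Ring.inverse_eq_inv', ← det_nonsing_inv, hC]
    simp only [det_mul]
    ring
  have h1 : (C * N * Cᴴ).det ≤ 1 := by
    refine hP.det_le_trace_div_three_pow.trans (pow_le_one₀ ?_ ?_)
    · exact div_nonneg hP.trace_nonneg (by norm_num)
    · rw [htr]
      linarith
  rwa [hd, inv_mul_le_one₀ hdet] at h1

open Matrix in
lemma Matrix.det_smul_add_smul_vecMulVec_self {M : Matrix (Fin 3) (Fin 3) ℝ} (hM : M.det ≠ 0)
    (a c : ℝ) (z : Fin 3 → ℝ) :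
    (a • M + c • vecMulVec z z).det = M.det * a ^ 2 * (a + c * (z ⬝ᵥ M⁻¹ *ᵥ z)) := by
  have h : M.det * (z ⬝ᵥ M⁻¹ *ᵥ z) = z ⬝ᵥ M.adjugate *ᵥ z := by
    rw [inv_def, smul_mulVec, dotProduct_smul, smul_eq_mul, Ring.inverse_eq_inv',
      mul_inv_cancel_left₀ hM]
  calc (a • M + c • vecMulVec z z).det
      = M.det * a ^ 3 + a ^ 2 * c * (z ⬝ᵥ M.adjugate *ᵥ z) := by
        simp only [det_fin_three, adjugate_fin_three, add_apply, smul_apply, vecMulVec_apply,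
          dotProduct, mulVec, Fin.sum_univ_three, smul_eq_mul, of_apply, cons_val]
        ring
    _ = _ := by
        rw [← h]
        ring

lemma le_three_of_forall_sq_mul_le_one {s : ℝ}
    (h : ∀ t ∈ Set.Icc (0 : ℝ) 1, (1 - t) ^ 2 * (1 - t + t * s) ≤ 1) : s ≤ 3 := by
  by_contra! hs
  have hpos : 0 < 2 * (2 * s - 3) := by linarith
  obtain ⟨t, ht⟩ : ∃ t, t * (2 * (2 * s - 3)) = s - 3 :=
    ⟨(s - 3) / (2 * (2 * s - 3)), div_mul_cancel₀ _ hpos.ne'⟩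
  have ht0 : 0 < t := by
    by_contra! h0
    nlinarith
  have ht1 : t ≤ 1 := by
    by_contra! h1
    nlinarith
  have h2 : 0 < t * ((s - 3) - t * (2 * s - 3)) := mul_pos ht0 (by linarith)
  have h3 : 0 ≤ t ^ 3 * (s - 1) := mul_nonneg (by positivity) (by linarith)
  nlinarith [h t ⟨ht0.le, ht1⟩]

section InfoMat

variable {ν : ℝ → ℝ} {β0 β1 β2 : ℝ}

lemma posSemidef_infoMat (hν : ∀ t, 0 < ν t) {m : ℕ} (x : Fin m → ℝ × ℝ) {p : Fin m → ℝ}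
    (hp : ∀ i, 0 ≤ p i) : (infoMat ν β0 β1 β2 m x p).PosSemidef := by
  refine Matrix.posSemidef_sum _ fun i _ => Matrix.PosSemidef.smul ?_ ?_
  · simpa using Matrix.posSemidef_vecMulVec_self_star ![1, (x i).1, (x i).2]
  · exact mul_nonneg (hp i) (hν _).le

open Matrix in
/-- Sufficiency half of the equivalence theorem for D-optimality: a nonsingular design whose
sensitivity function is at most `3` on `R` maximizes the determinant. -/
lemma det_infoMat_le_of_sensitivity_le_three (hν : ∀ t, 0 < ν t) {R : Set (ℝ × ℝ)}
    {M : Matrix (Fin 3) (Fin 3) ℝ} (hM : M.PosSemidef) (hdet : 0 < M.det)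
    (hsens : ∀ y ∈ R, ν (β0 + β1 * y.1 + β2 * y.2) *
      (![1, y.1, y.2] ⬝ᵥ M⁻¹ *ᵥ ![1, y.1, y.2]) ≤ 3)
    {m : ℕ} {x : Fin m → ℝ × ℝ} {p : Fin m → ℝ} (hx : ∀ i, x i ∈ R) (hp0 : ∀ i, 0 ≤ p i)
    (hp1 : ∑ i, p i = 1) : (infoMat ν β0 β1 β2 m x p).det ≤ M.det := by
  refine det_le_det_of_trace_inv_mul_le hM hdet (posSemidef_infoMat hν x hp0) ?_
  calc (M⁻¹ * infoMat ν β0 β1 β2 m x p).trace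
      = ∑ i, p i * (ν (β0 + β1 * (x i).1 + β2 * (x i).2) *
          (![1, (x i).1, (x i).2] ⬝ᵥ M⁻¹ *ᵥ ![1, (x i).1, (x i).2])) := by
        simp only [infoMat, Matrix.mul_sum, trace_sum, Matrix.mul_smul, trace_smul,
          mul_vecMulVec, trace_vecMulVec, smul_eq_mul]
        refine Finset.sum_congr rfl fun i _ => ?_
        rw [dotProduct_comm (M⁻¹ *ᵥ _), mul_assoc]
    _ ≤ ∑ i, p i * 3 := Finset.sum_le_sum fun i _ =>
        mul_le_mul_of_nonneg_left (hsens _ (hx i)) (hp0 i)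
    _ = 3 := by rw [← Finset.sum_mul, hp1, one_mul]

lemma infoMat_corners_append (p : Fin 4 → ℝ) (a b c t : ℝ) :
    infoMat ν β0 β1 β2 5 ![(1, 1), (1, -1), (-1, 1), (-1, -1), (a, b)]
        ![c * p 0, c * p 1, c * p 2, c * p 3, t] =
      c • infoMat ν β0 β1 β2 4 ![(1, 1), (1, -1), (-1, 1), (-1, -1)] p +
        (t * ν (β0 + β1 * a + β2 * b)) • Matrix.vecMulVec ![1, a, b] ![1, a, b] := by
  simp only [infoMat, Fin.sum_univ_five, Fin.sum_univ_four, Matrix.cons_val]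
  module

lemma infoMat_corners_append_zero (p : Fin 4 → ℝ) (a b : ℝ) :
    infoMat ν β0 β1 β2 5 ![(1, 1), (1, -1), (-1, 1), (-1, -1), (a, b)]
        ![p 0, p 1, p 2, p 3, 0] =
      infoMat ν β0 β1 β2 4 ![(1, 1), (1, -1), (-1, 1), (-1, -1)] p := by
  simpa using infoMat_corners_append (ν := ν) (β0 := β0) (β1 := β1) (β2 := β2) p a b 1 0

lemma det_infoMat_corners_pos (hν : ∀ t, 0 < ν t) {p : Fin 4 → ℝ} (hp : ∀ i, 0 < p i) :
    0 < (infoMat ν β0 β1 β2 4 ![(1, 1), (1, -1), (-1, 1), (-1, -1)] p).det := by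
  have h (i : Fin 4) (t : ℝ) : 0 < p i * ν t := mul_pos (hp i) (hν t)
  simp only [infoMat, Fin.sum_univ_four, Matrix.cons_val]
  have h0 := h 0 (β0 + β1 * 1 + β2 * 1)
  have h1 := h 1 (β0 + β1 * 1 + β2 * -1)
  have h2 := h 2 (β0 + β1 * -1 + β2 * 1)
  have h3 := h 3 (β0 + β1 * -1 + β2 * -1)
  generalize p 0 * ν _ = w0 at *
  generalize p 1 * ν _ = w1 at *
  generalize p 2 * ν _ = w2 at *
  generalize p 3 * ν _ = w3 at *
  have : 0 < 16 * (w0 * w1 * w2 + w0 * w1 * w3 + w0 * w2 * w3 + w1 * w2 * w3) := by positivity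
  convert this using 1
  simp only [Matrix.det_fin_three, Matrix.add_apply, Matrix.smul_apply, Matrix.vecMulVec_apply,
    Matrix.cons_val, smul_eq_mul]
  ring

end InfoMat

/-- Theorem 5.1: the design supported on the four boundary points
`(1,1), (1,-1), (-1,1), (-1,-1)` with weights `p` is D-optimal on
`[-1,1] × [-1,1]` if and only if, for every `(a, b) ∈ [-1,1] × [-1,1]`, the
allocation `(p1, p2, p3, p4, 0)` is optimal among all allocations on the five
points `(1,1), (1,-1), (-1,1), (-1,-1), (a,b)`. -/
theorem stmt_18 (ν : ℝ → ℝ) (hν : ∀ t, 0 < ν t) (β0 β1 β2 : ℝ)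
    (p : Fin 4 → ℝ) (hp0 : ∀ i, 0 ≤ p i) (hp1 : ∑ i, p i = 1) :
    IsDOptimal ν β0 β1 β2 (Set.Icc (-1 : ℝ) 1 ×ˢ Set.Icc (-1 : ℝ) 1) 4
        ![(1, 1), (1, -1), (-1, 1), (-1, -1)] p ↔
      ∀ a b : ℝ, a ∈ Set.Icc (-1 : ℝ) 1 → b ∈ Set.Icc (-1 : ℝ) 1 →
        ∀ q : Fin 5 → ℝ, (∀ i, 0 ≤ q i) → (∑ i, q i = 1) →
          (infoMat ν β0 β1 β2 5 ![(1, 1), (1, -1), (-1, 1), (-1, -1), (a, b)] q).det ≤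
          (infoMat ν β0 β1 β2 5 ![(1, 1), (1, -1), (-1, 1), (-1, -1), (a, b)]
            ![p 0, p 1, p 2, p 3, 0]).det := by
  simp only [infoMat_corners_append_zero]
  constructor
  · rintro ⟨-, -, -, hopt⟩ a b ha hb q hq0 hq1
    refine hopt 5 _ q (fun i => ?_) hq0 hq1
    fin_cases i <;> simp_all
  · intro h
    have hdet : 0 < (infoMat ν β0 β1 β2 4 ![(1, 1), (1, -1), (-1, 1), (-1, -1)] p).det := by
      have hunif := h 0 0 (by simp) (by simp) ![1 / 4, 1 / 4, 1 / 4, 1 / 4, 0]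
        (fun i => by fin_cases i <;> simp) (by simp [Fin.sum_univ_five]; norm_num)
      rw [infoMat_corners_append_zero (fun _ => 1 / 4)] at hunif
      exact (det_infoMat_corners_pos hν fun _ => by norm_num).trans_le hunif
    refine ⟨fun i => by fin_cases i <;> simp, hp0, hp1, fun m x q hx hq0 hq1 => ?_⟩
    refine det_infoMat_le_of_sensitivity_le_three hν (posSemidef_infoMat hν _ hp0) hdet ?_ hx hq0
      hq1
    rintro ⟨a, b⟩ ⟨ha, hb⟩
    refine le_three_of_forall_sq_mul_le_one fun t ⟨ht0, ht1⟩ => ?_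
    have hmix := h a b ha hb
      ![(1 - t) * p 0, (1 - t) * p 1, (1 - t) * p 2, (1 - t) * p 3, t]
      (fun i => by
        have hc (j : Fin 4) : 0 ≤ (1 - t) * p j := mul_nonneg (sub_nonneg.mpr ht1) (hp0 j)
        fin_cases i
        exacts [hc 0, hc 1, hc 2, hc 3, ht0])
      (by
        rw [Fin.sum_univ_four] at hp1
        simp only [Fin.sum_univ_five, Matrix.cons_val]
        linear_combination (1 - t) * hp1)
    rw [infoMat_corners_append, Matrix.det_smul_add_smul_vecMulVec_self hdet.ne', mul_assoc,
      mul_le_iff_le_one_right hdet, mul_assoc t] at hmix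
    exact hmix
end

section
/- Fix ν : ℝ → (0, ∞) and β = (β0, β1, β2) ∈ ℝ³, and set w1 = ν(β0 + β1 + β2), w2 = ν(β0 + β1 − β2), w3 = ν(β0 − β1 + β2), w4 = ν(β0 − β1 − β2). Let (p1, p2, p3, p4) be a maximizer over the simplex S4 of f(p) = 16 (p1 p2 p3 w1 w2 w3 + p1 p2 p4 w1 w2 w4 + p1 p3 p4 w1 w3 w4 + p2 p3 p4 w2 w3 w4), and define for a, b ∈ ℝ: h(a,b) = p1 p2 w1 w2 + p1 p3 w1 w3 + p2 p4 w2 w4 + p3 p4 w3 w4 + b² (p1 p3 w1 w3 + p2 p3 w2 w3 + p1 p4 w1 w4 + p2 p4 w2 w4) + 2 b (−p1 p3 w1 w3 + p2 p4 w2 w4) + a² (p1 p2 w1 w2 + p2 p3 w2 w3 + p1 p4 w1 w4 + p3 p4 w3 w4) + 2 a (−p1 p2 w1 w2 + p3 p4 w3 w4) + 2 a b (p2 p3 w2 w3 − p1 p4 w1 w4). Then there exists a D-optimal design on [−1,1] × [−1,1] supported only on the four boundary points (1,1), (1,−1), (−1,1), (−1,−1) if and only if ν(β0 + a β1 + b β2)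 · h(a,b) ≤ (3/4) f(p1,p2,p3,p4) for all a, b ∈ [−1, 1]. -/
open Finset

open scoped Matrix

theorem Matrix.PosSemidef.det_le_one_of_trace_le {n : Type*} [Fintype n] [DecidableEq n]
    {A : Matrix n n ℝ} (hA : A.PosSemidef) (htr : A.trace ≤ Fintype.card n) : A.det ≤ 1 := by
  have hdet := hA.isHermitian.det_eq_prod_eigenvalues
  have htrace := hA.isHermitian.trace_eq_sum_eigenvalues
  simp only [RCLike.ofReal_real_eq_id, id] at hdet htrace
  rw [hdet]
  calc ∏ i, hA.isHermitian.eigenvalues i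
      ≤ ∏ i, Real.exp (hA.isHermitian.eigenvalues i - 1) := by
        refine Finset.prod_le_prod (fun i _ => hA.eigenvalues_nonneg i) fun i _ => ?_
        linarith [Real.add_one_le_exp (hA.isHermitian.eigenvalues i - 1)]
    _ = Real.exp (A.trace - Fintype.card n) := by
        rw [← Real.exp_sum, htrace]; simp
    _ ≤ 1 := Real.exp_le_one_iff.mpr (by linarith)

open scoped MatrixOrder in
/-- The sufficiency half of the equivalence theorem for D-optimality, at the level of matrices. -/
theorem Matrix.PosSemidef.det_le_det_of_trace_adjugate_mul_le {n : Type*} [Fintype n]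
    [DecidableEq n] {M N : Matrix n n ℝ} (hM : M.PosSemidef) (hN : N.PosSemidef)
    (hdet : 0 < M.det) (htr : (M.adjugate * N).trace ≤ Fintype.card n * M.det) :
    N.det ≤ M.det := by
  obtain ⟨B, hB⟩ := CStarAlgebra.nonneg_iff_eq_star_mul_self.mp hM.nonneg
  rw [Matrix.star_eq_conjTranspose] at hB
  have hMB : M.det = B.det * B.det := by
    rw [hB, Matrix.det_mul, Matrix.det_conjTranspose, star_trivial]
  have hB0 : B.det ≠ 0 := fun h0 => by simp [hMB, h0] at hdet
  have hinv : M⁻¹ = B⁻¹ * (B⁻¹)ᴴ := by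
    rw [hB, Matrix.mul_inv_rev, Matrix.conjTranspose_nonsing_inv]
  have hC := hN.conjTranspose_mul_mul_same B⁻¹
  have htrC : ((B⁻¹)ᴴ * N * B⁻¹).trace ≤ Fintype.card n := by
    rw [Matrix.trace_mul_comm, ← Matrix.mul_assoc, ← hinv, Matrix.inv_def, Matrix.smul_mul,
      Matrix.trace_smul, Ring.inverse_eq_inv', smul_eq_mul, inv_mul_le_iff₀ hdet]
    linarith
  have hle := hC.det_le_one_of_trace_le htrC
  rw [Matrix.det_mul, Matrix.det_mul, Matrix.det_conjTranspose, star_trivial, Matrix.det_nonsing_inv,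
    Ring.inverse_eq_inv'] at hle
  have heq : B.det⁻¹ * N.det * B.det⁻¹ = N.det / M.det := by
    rw [hMB]; field_simp
  rwa [heq, div_le_one hdet] at hle

theorem Matrix.det_smul_add_smul_vecMulVec_fin_three (M : Matrix (Fin 3) (Fin 3) ℝ)
    (v : Fin 3 → ℝ) (r s : ℝ) :
    (r • M + s • Matrix.vecMulVec v v).det =
      r ^ 3 * M.det + r ^ 2 * s * (M.adjugate * Matrix.vecMulVec v v).trace := by
  rw [Matrix.det_fin_three, Matrix.det_fin_three, Matrix.adjugate_fin_three,
    Matrix.trace_fin_three]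
  simp [Matrix.mul_apply, Fin.sum_univ_three, Matrix.vecMulVec_apply]
  ring

theorem infoMat_posSemidef {ν : ℝ → ℝ} (hν : ∀ t, 0 < ν t) (β0 β1 β2 : ℝ) (m : ℕ)
    (x : Fin m → ℝ × ℝ) {p : Fin m → ℝ} (hp : ∀ i, 0 ≤ p i) :
    (infoMat ν β0 β1 β2 m x p).PosSemidef := by
  refine Matrix.posSemidef_sum _ fun i _ => ?_
  refine Matrix.PosSemidef.smul ?_ (mul_nonneg (hp i) (hν _).le)
  simpa using Matrix.posSemidef_vecMulVec_self_star ![1, (x i).1, (x i).2]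

theorem trace_mul_infoMat (A : Matrix (Fin 3) (Fin 3) ℝ) (ν : ℝ → ℝ) (β0 β1 β2 : ℝ) (m : ℕ)
    (x : Fin m → ℝ × ℝ) (p : Fin m → ℝ) :
    (A * infoMat ν β0 β1 β2 m x p).trace =
      ∑ i, p i * (ν (β0 + β1 * (x i).1 + β2 * (x i).2) *
        (A * Matrix.vecMulVec ![1, (x i).1, (x i).2] ![1, (x i).1, (x i).2]).trace) := by
  simp only [infoMat, Matrix.mul_sum, Matrix.trace_sum, Matrix.mul_smul, Matrix.trace_smul,
    smul_eq_mul, mul_assoc]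

theorem infoMat_corners (ν : ℝ → ℝ) (β0 β1 β2 : ℝ) (q : Fin 4 → ℝ) {u1 u2 u3 u4 : ℝ}
    (h1 : u1 = q 0 * ν (β0 + β1 + β2)) (h2 : u2 = q 1 * ν (β0 + β1 - β2))
    (h3 : u3 = q 2 * ν (β0 - β1 + β2)) (h4 : u4 = q 3 * ν (β0 - β1 - β2)) :
    infoMat ν β0 β1 β2 4 ![(1, 1), (1, -1), (-1, 1), (-1, -1)] q =
      !![u1 + u2 + u3 + u4, u1 + u2 - u3 - u4, u1 - u2 + u3 - u4;
         u1 + u2 - u3 - u4, u1 + u2 + u3 + u4, u1 - u2 - u3 + u4;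
         u1 - u2 + u3 - u4, u1 - u2 - u3 + u4, u1 + u2 + u3 + u4] := by
  subst h1 h2 h3 h4
  ext i j
  fin_cases i <;> fin_cases j <;>
    simp [infoMat, Fin.sum_univ_four, Matrix.add_apply, ← sub_eq_add_neg]

theorem det_infoMat_corners (ν : ℝ → ℝ) (β0 β1 β2 : ℝ) (q : Fin 4 → ℝ) {w1 w2 w3 w4 : ℝ}
    (hw1 : w1 = ν (β0 + β1 + β2)) (hw2 : w2 = ν (β0 + β1 - β2))
    (hw3 : w3 = ν (β0 - β1 + β2)) (hw4 : w4 = ν (β0 - β1 - β2)) :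
    (infoMat ν β0 β1 β2 4 ![(1, 1), (1, -1), (-1, 1), (-1, -1)] q).det =
      16 * (q 0*q 1*q 2*w1*w2*w3 + q 0*q 1*q 3*w1*w2*w4 + q 0*q 2*q 3*w1*w3*w4 +
        q 1*q 2*q 3*w2*w3*w4) := by
  subst hw1 hw2 hw3 hw4
  rw [infoMat_corners ν β0 β1 β2 q rfl rfl rfl rfl, Matrix.det_fin_three]
  simp
  ring

theorem trace_adjugate_infoMat_corners (ν : ℝ → ℝ) (β0 β1 β2 a b : ℝ) {p1 p2 p3 p4 : ℝ}
    {w1 w2 w3 w4 : ℝ}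
    (hw1 : w1 = ν (β0 + β1 + β2)) (hw2 : w2 = ν (β0 + β1 - β2))
    (hw3 : w3 = ν (β0 - β1 + β2)) (hw4 : w4 = ν (β0 - β1 - β2)) :
    ((infoMat ν β0 β1 β2 4 ![(1, 1), (1, -1), (-1, 1), (-1, -1)] ![p1, p2, p3, p4]).adjugate *
      Matrix.vecMulVec ![1, a, b] ![1, a, b]).trace =
      4 * (p1*p2*w1*w2 + p1*p3*w1*w3 + p2*p4*w2*w4 + p3*p4*w3*w4
      + b^2 * (p1*p3*w1*w3 + p2*p3*w2*w3 + p1*p4*w1*w4 + p2*p4*w2*w4)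
      + 2*b * (-(p1*p3*w1*w3) + p2*p4*w2*w4)
      + a^2 * (p1*p2*w1*w2 + p2*p3*w2*w3 + p1*p4*w1*w4 + p3*p4*w3*w4)
      + 2*a * (-(p1*p2*w1*w2) + p3*p4*w3*w4)
      + 2*a*b * (p2*p3*w2*w3 - p1*p4*w1*w4)) := by
  subst hw1 hw2 hw3 hw4
  rw [infoMat_corners ν β0 β1 β2 ![p1, p2, p3, p4] rfl rfl rfl rfl, Matrix.adjugate_fin_three,
    Matrix.trace_fin_three]
  simp [Matrix.mul_apply, Fin.sum_univ_three]
  ring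

theorem infoMat_snoc (ν : ℝ → ℝ) (β0 β1 β2 : ℝ) (m : ℕ) (x : Fin m → ℝ × ℝ) (p : Fin m → ℝ)
    (y : ℝ × ℝ) (t : ℝ) :
    infoMat ν β0 β1 β2 (m + 1) (Fin.snoc x y : Fin (m + 1) → ℝ × ℝ)
        (Fin.snoc (fun i => (1 - t) * p i) t : Fin (m + 1) → ℝ) =
      (1 - t) • infoMat ν β0 β1 β2 m x p +
        (t * ν (β0 + β1 * y.1 + β2 * y.2)) •
          Matrix.vecMulVec ![1, y.1, y.2] ![1, y.1, y.2] := by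
  simp [infoMat, Fin.sum_univ_castSucc, Finset.smul_sum, smul_smul, mul_assoc]

theorem le_three_mul_of_forall_mix_le {f S : ℝ} (hf : 0 ≤ f)
    (H : ∀ t : ℝ, 0 ≤ t → t ≤ 1 → (1 - t) ^ 3 * f + (1 - t) ^ 2 * (t * S) ≤ f) : S ≤ 3 * f := by
  by_contra! hlt
  have hS : 0 < S := by linarith
  set t := (S - 3 * f) / (4 * S) with ht
  have htS : 4 * (t * S) = S - 3 * f := by rw [ht]; field_simp
  have ht0 : 0 < t := div_pos (by linarith) (by linarith)
  have ht1 : t ≤ 1 := by rw [ht, div_le_one (by linarith)]; linarith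
  have hH := H t ht0.le ht1
  have hfac : t * (S - 3 * f - 2 * (t * S) + t ^ 2 * S + t * f * (3 - t)) ≤ 0 := by linarith
  have hpos : 0 < S - 3 * f - 2 * (t * S) + t ^ 2 * S + t * f * (3 - t) := by
    have : 0 ≤ t ^ 2 * S := by positivity
    have : 0 ≤ t * f * (3 - t) := mul_nonneg (by positivity) (by linarith)
    linarith
  exact (mul_pos ht0 hpos).not_ge hfac

/-- The necessity half of the equivalence theorem: the sensitivity function of a D-optimal design
is at most the number of parameters. -/
theorem IsDOptimal.sensitivity_le {ν : ℝ → ℝ} (hν : ∀ t, 0 < ν t) {β0 β1 β2 : ℝ}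
    {R : Set (ℝ × ℝ)} {m : ℕ} {x : Fin m → ℝ × ℝ} {p : Fin m → ℝ}
    (H : IsDOptimal ν β0 β1 β2 R m x p) {y : ℝ × ℝ} (hy : y ∈ R) :
    ν (β0 + β1 * y.1 + β2 * y.2) *
      ((infoMat ν β0 β1 β2 m x p).adjugate *
        Matrix.vecMulVec ![1, y.1, y.2] ![1, y.1, y.2]).trace ≤
      3 * (infoMat ν β0 β1 β2 m x p).det := by
  obtain ⟨hx, hp, hsum, hopt⟩ := H
  refine le_three_mul_of_forall_mix_le (infoMat_posSemidef hν β0 β1 β2 m x hp).det_nonneg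
    fun t ht0 ht1 => ?_
  have key := hopt (m + 1) (Fin.snoc x y : Fin (m + 1) → ℝ × ℝ)
    (Fin.snoc (fun i => (1 - t) * p i) t : Fin (m + 1) → ℝ)
    (fun i => by refine Fin.lastCases ?_ (fun j => ?_) i <;> simp [hy, hx])
    (fun i => by
      refine Fin.lastCases ?_ (fun j => ?_) i
      · simpa using ht0
      · simpa using mul_nonneg (sub_nonneg.mpr ht1) (hp j))
    (by simp [Fin.sum_univ_castSucc, ← Finset.mul_sum, hsum])
  rw [infoMat_snoc, Matrix.det_smul_add_smul_vecMulVec_fin_three] at key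
  linarith

/-- The sufficiency half of the equivalence theorem: a nonsingular design whose sensitivity function
is at most the number of parameters is D-optimal. -/
theorem IsDOptimal.of_sensitivity_le {ν : ℝ → ℝ} (hν : ∀ t, 0 < ν t) {β0 β1 β2 : ℝ}
    {R : Set (ℝ × ℝ)} {m : ℕ} {x : Fin m → ℝ × ℝ} {p : Fin m → ℝ}
    (hx : ∀ i, x i ∈ R) (hp : ∀ i, 0 ≤ p i) (hsum : ∑ i, p i = 1)
    (hdet : 0 < (infoMat ν β0 β1 β2 m x p).det)
    (H : ∀ y ∈ R, ν (β0 + β1 * y.1 + β2 * y.2) *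
      ((infoMat ν β0 β1 β2 m x p).adjugate *
        Matrix.vecMulVec ![1, y.1, y.2] ![1, y.1, y.2]).trace ≤
      3 * (infoMat ν β0 β1 β2 m x p).det) :
    IsDOptimal ν β0 β1 β2 R m x p := by
  refine ⟨hx, hp, hsum, fun m' x' p' hx' hp' hsum' => ?_⟩
  refine (infoMat_posSemidef hν β0 β1 β2 m x hp).det_le_det_of_trace_adjugate_mul_le
    (infoMat_posSemidef hν β0 β1 β2 m' x' hp') hdet ?_
  rw [trace_mul_infoMat]
  refine (Finset.sum_le_sum fun i _ =>
    mul_le_mul_of_nonneg_left (H (x' i) (hx' i)) (hp' i)).trans ?_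
  rw [← Finset.sum_mul, hsum']
  simp

/-- Theorem 5.2: a D-optimal design with two quantitative factors
`x1, x2 ∈ [-1,1]` can be constructed on the four boundary points only if and
only if `ν(β0 + aβ1 + bβ2) h(a,b) ≤ (3/4) f(p)` for all `a, b ∈ [-1,1]`, where
`p` is the D-optimal allocation for the `2²` main-effects model. -/
theorem stmt_19 (ν : ℝ → ℝ) (hν : ∀ t, 0 < ν t) (β0 β1 β2 : ℝ)
    (w1 w2 w3 w4 : ℝ)
    (hw1 : w1 = ν (β0 + β1 + β2)) (hw2 : w2 = ν (β0 + β1 - β2))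
    (hw3 : w3 = ν (β0 - β1 + β2)) (hw4 : w4 = ν (β0 - β1 - β2))
    (p1 p2 p3 p4 : ℝ)
    (hp1 : 0 ≤ p1) (hp2 : 0 ≤ p2) (hp3 : 0 ≤ p3) (hp4 : 0 ≤ p4)
    (hpsum : p1 + p2 + p3 + p4 = 1)
    (hmax : ∀ q1 q2 q3 q4 : ℝ, 0 ≤ q1 → 0 ≤ q2 → 0 ≤ q3 → 0 ≤ q4 →
      q1 + q2 + q3 + q4 = 1 →
      16 * (q1*q2*q3*w1*w2*w3 + q1*q2*q4*w1*w2*w4 + q1*q3*q4*w1*w3*w4 +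
        q2*q3*q4*w2*w3*w4) ≤
      16 * (p1*p2*p3*w1*w2*w3 + p1*p2*p4*w1*w2*w4 + p1*p3*p4*w1*w3*w4 +
        p2*p3*p4*w2*w3*w4))
    (h : ℝ → ℝ → ℝ)
    (hdef : ∀ a b : ℝ, h a b =
      p1*p2*w1*w2 + p1*p3*w1*w3 + p2*p4*w2*w4 + p3*p4*w3*w4
      + b^2 * (p1*p3*w1*w3 + p2*p3*w2*w3 + p1*p4*w1*w4 + p2*p4*w2*w4)
      + 2*b * (-(p1*p3*w1*w3) + p2*p4*w2*w4)
      + a^2 * (p1*p2*w1*w2 + p2*p3*w2*w3 + p1*p4*w1*w4 + p3*p4*w3*w4)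
      + 2*a * (-(p1*p2*w1*w2) + p3*p4*w3*w4)
      + 2*a*b * (p2*p3*w2*w3 - p1*p4*w1*w4)) :
    (∃ q : Fin 4 → ℝ,
      IsDOptimal ν β0 β1 β2 (Set.Icc (-1 : ℝ) 1 ×ˢ Set.Icc (-1 : ℝ) 1) 4
        ![(1, 1), (1, -1), (-1, 1), (-1, -1)] q) ↔
    (∀ a b : ℝ, a ∈ Set.Icc (-1 : ℝ) 1 → b ∈ Set.Icc (-1 : ℝ) 1 →
      ν (β0 + a * β1 + b * β2) * h a b ≤
      3 / 4 * (16 * (p1*p2*p3*w1*w2*w3 + p1*p2*p4*w1*w2*w4 + p1*p3*p4*w1*w3*w4 +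
        p2*p3*p4*w2*w3*w4))) := by
  have hx : ∀ i, (![(1, 1), (1, -1), (-1, 1), (-1, -1)] : Fin 4 → ℝ × ℝ) i ∈
      Set.Icc (-1 : ℝ) 1 ×ˢ Set.Icc (-1 : ℝ) 1 := by
    intro i
    fin_cases i <;> norm_num
  have hp : ∀ i, 0 ≤ (![p1, p2, p3, p4] : Fin 4 → ℝ) i := by
    intro i
    fin_cases i <;> simpa
  have hsum : ∑ i, (![p1, p2, p3, p4] : Fin 4 → ℝ) i = 1 := by
    simpa [Fin.sum_univ_four] using hpsum
  have hdet := det_infoMat_corners ν β0 β1 β2 ![p1, p2, p3, p4] hw1 hw2 hw3 hw4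
  simp only [Matrix.cons_val] at hdet
  have htr : ∀ a b : ℝ, _ = 4 * h a b := fun a b =>
    (trace_adjugate_infoMat_corners ν β0 β1 β2 a b hw1 hw2 hw3 hw4).trans
      (congrArg (4 * ·) (hdef a b).symm)
  constructor
  · rintro ⟨q, hxq, hq, hqsum, hqopt⟩ a b ha hb
    have hqmax := hmax (q 0) (q 1) (q 2) (q 3) (hq 0) (hq 1) (hq 2) (hq 3)
      (by simpa [Fin.sum_univ_four] using hqsum)
    rw [← det_infoMat_corners ν β0 β1 β2 q hw1 hw2 hw3 hw4, ← hdet] at hqmax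
    have hopt : IsDOptimal ν β0 β1 β2 (Set.Icc (-1 : ℝ) 1 ×ˢ Set.Icc (-1 : ℝ) 1) 4
        ![(1, 1), (1, -1), (-1, 1), (-1, -1)] ![p1, p2, p3, p4] :=
      ⟨hx, hp, hsum, fun m' x' p' h1 h2 h3 => (hqopt m' x' p' h1 h2 h3).trans hqmax⟩
    have hs := hopt.sensitivity_le hν (y := (a, b)) ⟨ha, hb⟩
    simp only [htr, hdet] at hs
    rw [mul_comm a, mul_comm b]
    linarith
  · intro H
    have hpos : 0 < (infoMat ν β0 β1 β2 4 ![(1, 1), (1, -1), (-1, 1), (-1, -1)]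
        ![p1, p2, p3, p4]).det := by
      have h1 : 0 < w1 := hw1 ▸ hν _
      have h2 : 0 < w2 := hw2 ▸ hν _
      have h3 : 0 < w3 := hw3 ▸ hν _
      have h4 : 0 < w4 := hw4 ▸ hν _
      rw [hdet]
      refine lt_of_lt_of_le ?_ (hmax (1 / 4) (1 / 4) (1 / 4) (1 / 4) (by norm_num) (by norm_num)
        (by norm_num) (by norm_num) (by norm_num))
      positivity
    refine ⟨![p1, p2, p3, p4], IsDOptimal.of_sensitivity_le hν hx hp hsum hpos ?_⟩
    rintro ⟨a, b⟩ ⟨ha, hb⟩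
    have hab := H a b ha hb
    simp only [htr, hdet]
    rw [mul_comm β1, mul_comm β2]
    linarith
end
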